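/- Let W ∈ 𝒲* with log W(N)/log N → 0, let L ∈ ℒ, and let ϑ : ℕ → ℕ satisfy the Gaussian condition with respect to L. Then the supremum, over all functions f : ℕ → ℂ with ‖f‖∞ ≤ 1, of | E^W_{n≤N} f(ϑ(n)) − E^W_{n≤N} ( E^{2bin}_{k≤L(n)} f(k) ) | tends to 0 as N → ∞. -/

import Mathlib

open Filter Finset

/-- Discrete derivative: `ΔW(N) = W(N) - W(N-1)` for `N ≥ 2`, and `ΔW(1) = W(1)`. -/
noncomputable def dd (W : ℕ → ℝ) (N : ℕ) : ℝ := if 2 ≤ N then W N - W (N - 1) else W 1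

/-- Weighted average `E^W_{n ≤ N} f(n) = (1/W(N)) ∑_{n=1}^N ΔW(n) f(n)`. -/
noncomputable def wAvg (W : ℕ → ℝ) (f : ℕ → ℂ) (N : ℕ) : ℂ :=
  (1 / (W N : ℂ)) * ∑ n ∈ Finset.Icc 1 N, (dd W n : ℂ) * f n

/-- Cesàro average `E_{n ≤ N} f(n) = (1/N) ∑_{n=1}^N f(n)`. -/
noncomputable def cesaro (f : ℕ → ℂ) (N : ℕ) : ℂ :=
  (1 / (N : ℂ)) * ∑ n ∈ Finset.Icc 1 N, f n

/-- Parity-neutral binomial mean. -/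
noncomputable def e2bin (f : ℕ → ℂ) (N : ℕ) : ℂ :=
  (1 / 2 ^ (N + 1) : ℂ) * ∑ n ∈ Finset.Icc 1 (2 * N), (Nat.choose N (n / 2) : ℂ) * f n

/-- Binomial mean. -/
noncomputable def ebin (f : ℕ → ℂ) (N : ℕ) : ℂ :=
  (1 / 2 ^ N : ℂ) * ∑ n ∈ Finset.Icc 1 N, (Nat.choose N n : ℂ) * f n

/-- The class 𝒲: eventually non-decreasing nonnegative functions tending to ∞. -/
def memW (W : ℕ → ℝ) : Prop :=
  (∀ n, 0 ≤ W n) ∧ (∃ N₀ : ℕ, ∀ m n : ℕ, N₀ ≤ m → m ≤ n → W m ≤ W n) ∧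
    Tendsto W atTop atTop

/-- The class 𝒲*: members of 𝒲 for which `N·Δ²W(N)/ΔW(N)` converges in `ℝ ∪ {±∞}`. -/
def memWstar (W : ℕ → ℝ) : Prop :=
  memW W ∧ ∃ l : EReal,
    Tendsto (fun N : ℕ => (((N : ℝ) * dd (dd W) N / dd W N : ℝ) : EReal)) atTop (nhds l)

/-- The class ℒ: members of 𝒲 (with values in ℕ) whose discrete derivative is
eventually in {0,1}. -/
def memL (L : ℕ → ℕ) : Prop :=
  memW (fun n => (L n : ℝ)) ∧
    ∃ N₀ : ℕ, ∀ n : ℕ, N₀ ≤ n → L n = L (n - 1) ∨ L n = L (n - 1) + 1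

/-- Gaussian probability density with mean μ and standard deviation σ. -/
noncomputable def gauss (x μ σ : ℝ) : ℝ :=
  (1 / (σ * Real.sqrt (2 * Real.pi))) * Real.exp (-(x - μ) ^ 2 / (2 * σ ^ 2))

/-- The Gaussian condition \eqref{gaussian_condition}. -/
def gaussCond (ϑ : ℕ → ℕ) (L : ℕ → ℕ) : Prop :=
  Tendsto (fun N : ℕ => ∑' k : ℕ,
      |(((Finset.Icc 1 N).filter (fun n => ϑ n = k + 1)).card : ℝ) / N -
        gauss (k + 1 : ℝ) (L N) (Real.sqrt (L N))|) atTop (nhds 0)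

/-- Ω(n): number of prime factors with multiplicity. -/
def bigOmega (n : ℕ) : ℕ := n.primeFactorsList.length

/-- ω(n): number of distinct prime factors. -/
def smallOmega (n : ℕ) : ℕ := n.primeFactors.card

/-- Uniform distribution mod 1. -/
def udMod1 (x : ℕ → ℝ) : Prop :=
  ∀ a b : ℝ, 0 ≤ a → a < b → b ≤ 1 →
    Tendsto (fun N : ℕ =>
        (((Finset.Icc 1 N).filter
            (fun n => a ≤ Int.fract (x n) ∧ Int.fract (x n) < b)).card : ℝ) / N)
      atTop (nhds (b - a))

theorem centralBinom_sq_mul_le (n : ℕ) :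
    (n.centralBinom : ℝ) ^ 2 * (Real.pi * n) ≤ 16 ^ n := by
  have hW := Real.Wallis.le_W n
  have hfac : (n.centralBinom : ℝ) * (n.factorial : ℝ) ^ 2 = ((2 * n).factorial : ℝ) := by
    have h := Nat.choose_mul_factorial_mul_factorial (show n ≤ 2 * n by omega)
    rw [show 2 * n - n = n by omega, ← Nat.centralBinom_eq_two_mul_choose] at h
    rw [← h]
    push_cast
    ring
  have hfn : (0 : ℝ) < n.factorial := by exact_mod_cast n.factorial_pos
  have hcb : (0 : ℝ) < n.centralBinom := by exact_mod_cast n.centralBinom_pos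
  have hWeq : Real.Wallis.W n = 16 ^ n / ((n.centralBinom : ℝ) ^ 2 * (2 * n + 1)) := by
    rw [Real.Wallis.W_eq_factorial_ratio, ← hfac, pow_mul]
    norm_num
    field_simp
  rw [hWeq, le_div_iff₀ (by positivity)] at hW
  refine le_trans ?_ hW
  have h : (Real.pi * n : ℝ) ≤ (2 * n + 1) / (2 * n + 2) * (Real.pi / 2) * (2 * n + 1) := by
    have : (n : ℝ) ≤ (2 * n + 1) / (2 * n + 2) * (1 / 2) * (2 * n + 1) := by
      rw [div_mul_eq_mul_div, div_mul_eq_mul_div, le_div_iff₀ (by positivity)]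
      nlinarith
    calc (Real.pi * n : ℝ) ≤ Real.pi * ((2 * n + 1) / (2 * n + 2) * (1 / 2) * (2 * n + 1)) := by
          gcongr
      _ = _ := by ring
  calc (n.centralBinom : ℝ) ^ 2 * (Real.pi * n)
      ≤ (n.centralBinom : ℝ) ^ 2 *
          ((2 * n + 1) / (2 * n + 2) * (Real.pi / 2) * (2 * n + 1)) := by gcongr
    _ = _ := by ring

theorem choose_half_le {L : ℕ} (hL : 0 < L) :
    (L.choose ((L + 1) / 2) : ℝ) ≤ 2 ^ (L + 1) / √(2 * Real.pi * L) := by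
  have hL' : (0 : ℝ) < L := by exact_mod_cast hL
  have hpi := Real.pi_pos
  rw [le_div_iff₀ (by positivity)]
  refine le_of_sq_le_sq ?_ (by positivity)
  rw [mul_pow, Real.sq_sqrt (by positivity)]
  obtain ⟨m, rfl | rfl⟩ := Nat.even_or_odd' L
  · rw [show (2 * m + 1) / 2 = m by omega, ← Nat.centralBinom_eq_two_mul_choose]
    have h := centralBinom_sq_mul_le m
    have e : (2 : ℝ) ^ (2 * m + 1) = 2 * 4 ^ m := by rw [pow_succ, pow_mul]; norm_num; ring
    have e' : (16 : ℝ) ^ m = (4 ^ m) ^ 2 := by rw [← pow_mul, mul_comm, pow_mul]; norm_num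
    rw [e]
    push_cast
    nlinarith
  · rw [show (2 * m + 1 + 1) / 2 = m + 1 by omega]
    have h := centralBinom_sq_mul_le (m + 1)
    have hc : ((m + 1).centralBinom : ℝ) = 2 * ((2 * m + 1).choose (m + 1) : ℝ) := by
      have : (m + 1).centralBinom = 2 * (2 * m + 1).choose (m + 1) := by
        rw [Nat.centralBinom_eq_two_mul_choose, show 2 * (m + 1) = 2 * m + 1 + 1 by ring,
          Nat.choose_succ_succ, ← Nat.choose_symm_half]
        ring
      exact_mod_cast this
    have e : (2 : ℝ) ^ (2 * m + 1 + 1) = 4 ^ (m + 1) := by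
      rw [show 2 * m + 1 + 1 = 2 * (m + 1) by ring, pow_mul]; norm_num
    have e' : (16 : ℝ) ^ (m + 1) = (4 ^ (m + 1)) ^ 2 := by
      rw [← pow_mul, mul_comm, pow_mul]; norm_num
    rw [hc, e'] at h
    rw [e]
    push_cast at h ⊢
    have : 0 ≤ ((2 * m + 1).choose (m + 1) : ℝ) ^ 2 * Real.pi := by positivity
    nlinarith

theorem one_sub_mul_exp_two_mul_le {s : ℝ} (hs : 0 ≤ s) :
    (1 - s) * Real.exp (2 * s) ≤ 1 + s := by
  rcases le_or_gt 1 s with h1 | h1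
  · have : (1 - s) * Real.exp (2 * s) ≤ 0 :=
      mul_nonpos_of_nonpos_of_nonneg (by linarith) (Real.exp_pos _).le
    linarith
  · have h := Real.hasSum_log_sub_log_of_abs_lt_one (x := s) (by rw [abs_of_nonneg hs]; exact h1)
    have h2 : 2 * s ≤ Real.log (1 + s) - Real.log (1 - s) := by
      have := h.summable.sum_le_tsum (range 1) (fun k _ => by positivity)
      rw [h.tsum_eq] at this
      simpa using this
    rw [← Real.log_div (by linarith) (by linarith), Real.le_log_iff_exp_le
      (div_pos (by linarith) (by linarith)), le_div_iff₀ (by linarith)] at h2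
    linarith

theorem choose_mul_exp_le_of_half_le {L j : ℕ} (hL : 0 < L) (hj : L ≤ 2 * j) :
    (L.choose j : ℝ) * Real.exp (((2 * j - L : ℝ) ^ 2 - 1) / (2 * (L + 1))) ≤
      2 ^ (L + 1) / √(2 * Real.pi * L) := by
  have hj' : (L + 1) / 2 ≤ j := by omega
  clear hj
  induction j, hj' using Nat.le_induction with
  | base =>
    refine le_trans (mul_le_of_le_one_right (by positivity) ?_) (choose_half_le hL)
    rw [Real.exp_le_one_iff]
    refine div_nonpos_of_nonpos_of_nonneg ?_ (by positivity)
    obtain ⟨m, rfl | rfl⟩ := Nat.even_or_odd' L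
    · rw [show (2 * m + 1) / 2 = m by omega]
      push_cast
      norm_num
    · rw [show (2 * m + 1 + 1) / 2 = m + 1 by omega]
      push_cast
      ring_nf
      norm_num
  | succ j hj ih =>
    refine le_trans ?_ ih
    rcases lt_or_ge L (j + 1) with hlt | hle
    · rw [Nat.choose_eq_zero_of_lt hlt]
      simp only [Nat.cast_zero, zero_mul]
      positivity
    have hLp : (0 : ℝ) < L + 1 := by positivity
    set s : ℝ := (2 * j + 1 - L) / (L + 1) with hs
    have hs0 : 0 ≤ s := by
      refine div_nonneg ?_ hLp.le
      have : (L : ℝ) ≤ 2 * j + 1 := by exact_mod_cast (by omega : L ≤ 2 * j + 1)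
      linarith
    have hexp : ((2 * ((j + 1 : ℕ) : ℝ) - L) ^ 2 - 1) / (2 * (L + 1)) =
        ((2 * j - L : ℝ) ^ 2 - 1) / (2 * (L + 1)) + 2 * s := by
      rw [hs]
      push_cast
      field_simp
      ring
    have hrec : (L.choose (j + 1) : ℝ) * (1 + s) = L.choose j * (1 - s) := by
      have h := Nat.choose_succ_right_eq L j
      have h' : (L.choose (j + 1) : ℝ) * (j + 1) = L.choose j * (L - j) := by
        rw [← Nat.cast_sub (by omega)]
        exact_mod_cast h
      have e1 : 1 + s = 2 * (j + 1) / (L + 1) := by rw [hs]; field_simp; ring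
      have e2 : 1 - s = 2 * (L - j) / (L + 1) := by rw [hs]; field_simp; ring
      rw [e1, e2, mul_div_assoc', mul_div_assoc']
      congr 1
      linarith
    rw [hexp, Real.exp_add]
    set E := Real.exp (((2 * j - L : ℝ) ^ 2 - 1) / (2 * (L + 1)))
    have hE : 0 < E := Real.exp_pos _
    have key := one_sub_mul_exp_two_mul_le hs0
    refine le_of_mul_le_mul_right ?_ (show 0 < 1 + s by linarith)
    calc (L.choose (j + 1) : ℝ) * (E * Real.exp (2 * s)) * (1 + s)
        = (L.choose (j + 1) : ℝ) * (1 + s) * (E * Real.exp (2 * s)) := by ring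
      _ = L.choose j * E * ((1 - s) * Real.exp (2 * s)) := by rw [hrec]; ring
      _ ≤ L.choose j * E * (1 + s) := by gcongr

theorem choose_mul_exp_le {L : ℕ} (hL : 0 < L) (j : ℕ) :
    (L.choose j : ℝ) * Real.exp (((2 * j - L : ℝ) ^ 2 - 1) / (2 * (L + 1))) ≤
      2 ^ (L + 1) / √(2 * Real.pi * L) := by
  rcases le_total L (2 * j) with h | h
  · exact choose_mul_exp_le_of_half_le hL h
  · have hj : j ≤ L := by omega
    have := choose_mul_exp_le_of_half_le hL (show L ≤ 2 * (L - j) by omega)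
    rw [Nat.choose_symm hj, Nat.cast_sub hj] at this
    convert this using 5
    ring

/-- The density of the parity-neutral binomial mean of length `L`. -/
noncomputable def binDensity (L k : ℕ) : ℝ := L.choose (k / 2) / 2 ^ (L + 1)

theorem binDensity_nonneg (L k : ℕ) : 0 ≤ binDensity L k := by
  unfold binDensity; positivity

theorem binDensity_sub_gauss_le {L : ℕ} (hL : 0 < L) (k : ℕ) :
    binDensity L k - gauss k L √L ≤
      binDensity L k * ((2 * (k / 2 : ℕ) - L : ℝ) ^ 2 / (L * √L) + 3 / √L) := by
  have hL' : (1 : ℝ) ≤ L := by exact_mod_cast hL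
  have hL0 : (0 : ℝ) < L := by linarith
  set j := k / 2 with hj
  set y : ℝ := 2 * (j : ℝ) - L with hy
  have hpi := Real.pi_pos
  have hs0 : 0 < √(L : ℝ) := Real.sqrt_pos.mpr hL0
  have hss : √(L : ℝ) ^ 2 = L := Real.sq_sqrt hL0.le
  have hs1 : 1 ≤ √(L : ℝ) := Real.one_le_sqrt.mpr hL'
  set x : ℝ := k - L with hx
  have hxy : x ^ 2 ≤ y ^ 2 + 2 * |y| + 1 := by
    have h1 : x = y ∨ x = y + 1 := by
      rcases Nat.even_or_odd' k with ⟨m, rfl | rfl⟩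
      · left; rw [hx, hy, hj, show 2 * m / 2 = m by omega]; push_cast; ring
      · right; rw [hx, hy, hj, show (2 * m + 1) / 2 = m by omega]; push_cast; ring
    rcases h1 with h | h <;> rw [h]
    · linarith [abs_nonneg y]
    · nlinarith [le_abs_self y]
  set δ : ℝ := x ^ 2 / (2 * L) - (y ^ 2 - 1) / (2 * (L + 1)) with hδ
  have hδle : δ ≤ y ^ 2 / (L * √L) + 3 / √L := by
    have hab : 2 * |y| ≤ y ^ 2 / √L + √L := by
      have : 0 ≤ (|y| - √L) ^ 2 / √L := by positivity
      have e : (|y| - √L) ^ 2 / √L = y ^ 2 / √L - 2 * |y| + √L := by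
        rw [sub_sq, sq_abs]
        field_simp
      linarith
    have h1 : x ^ 2 / (2 * L) ≤ (y ^ 2 + (y ^ 2 / √L + √L) + 1) / (2 * L) := by
      gcongr; linarith
    have h2 : y ^ 2 / (2 * L) - y ^ 2 / (2 * (L + 1)) ≤ y ^ 2 / (2 * (L * √L)) := by
      have e : y ^ 2 / (2 * L) - y ^ 2 / (2 * (L + 1)) = y ^ 2 / (2 * (L * (L + 1))) := by
        field_simp
        ring
      rw [e]
      gcongr
      nlinarith
    have h3 : √(L : ℝ) / (2 * L) = 1 / (2 * √L) := by
      rw [div_eq_div_iff (by positivity) (by positivity)]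
      nlinarith
    have h4 : 1 / (2 * (L : ℝ)) ≤ 1 / √L := by gcongr; nlinarith
    have h5 : 1 / (2 * ((L : ℝ) + 1)) ≤ 1 / √L := by gcongr; nlinarith
    have h6 : 1 / (2 * √(L : ℝ)) ≤ 1 / √L := by gcongr; nlinarith
    have e1 : (y ^ 2 + (y ^ 2 / √L + √L) + 1) / (2 * L) =
        y ^ 2 / (2 * L) + y ^ 2 / (2 * (L * √L)) + √L / (2 * L) + 1 / (2 * L) := by
      field_simp
      ring
    have e2 : y ^ 2 / (L * √L) = y ^ 2 / (2 * (L * √L)) + y ^ 2 / (2 * (L * √L)) := by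
      field_simp; ring
    have e3 : 3 / √(L : ℝ) = 1 / √L + 1 / √L + 1 / √L := by ring
    have e4 : (y ^ 2 - 1) / (2 * ((L : ℝ) + 1)) =
      y ^ 2 / (2 * (L + 1)) - 1 / (2 * (L + 1)) := sub_div _ _ _
    rw [hδ, e2, e3, e4]
    linarith
  have hg : binDensity L k * Real.exp (-δ) ≤ gauss k L √L := by
    have h := choose_mul_exp_le hL j
    have e : gauss k L √L = 1 / √(2 * Real.pi * L) * Real.exp (-(x ^ 2 / (2 * L))) := by
      rw [gauss, hss, ← hx, neg_div]
      congr 2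
      rw [← Real.sqrt_mul hL0.le]
      congr 1
      ring
    rw [e, hδ, neg_sub, sub_eq_add_neg, Real.exp_add, ← mul_assoc]
    refine mul_le_mul_of_nonneg_right ?_ (Real.exp_pos _).le
    rw [binDensity, div_mul_eq_mul_div, div_le_iff₀ (by positivity)]
    refine h.trans (le_of_eq ?_)
    ring
  have hq := binDensity_nonneg L k
  have h1 : 1 - δ ≤ Real.exp (-δ) := by linarith [Real.add_one_le_exp (-δ)]
  have h2 := mul_le_mul_of_nonneg_left h1 hq
  have h3 := mul_le_mul_of_nonneg_left hδle hq
  linarith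

theorem sum_range_two_mul_half {M : Type*} [AddCommMonoid M] (u : ℕ → M) (n : ℕ) :
    ∑ k ∈ range (2 * n), u (k / 2) = 2 • ∑ j ∈ range n, u j := by
  induction n with
  | zero => simp
  | succ n ih =>
    rw [show 2 * (n + 1) = 2 * n + 1 + 1 by ring, sum_range_succ, sum_range_succ, ih,
      sum_range_succ, show 2 * n / 2 = n by omega, show (2 * n + 1) / 2 = n by omega,
      smul_add, two_nsmul (u n), add_assoc]

theorem sum_binDensity (L : ℕ) : ∑ k ∈ range (2 * (L + 1)), binDensity L k = 1 := by
  have h := sum_range_two_mul_half (fun j => (L.choose j : ℝ) / 2 ^ (L + 1)) (L + 1)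
  unfold binDensity
  rw [h, ← sum_div, two_nsmul, ← add_div]
  have : (∑ j ∈ range (L + 1), (L.choose j : ℝ)) = 2 ^ L := by
    exact_mod_cast Nat.sum_range_choose L
  rw [this, pow_succ]
  field_simp
  norm_num

theorem sum_binDensity_mul_sq (L : ℕ) :
    ∑ k ∈ range (2 * (L + 1)), binDensity L k * (2 * (k / 2 : ℕ) - L : ℝ) ^ 2 = L := by
  have h := sum_range_two_mul_half
    (fun j => (L.choose j : ℝ) / 2 ^ (L + 1) * (2 * j - L : ℝ) ^ 2) (L + 1)
  unfold binDensity
  rw [h]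
  have hv := congrArg (Polynomial.eval (1 / 2 : ℝ)) (bernsteinPolynomial.variance (R := ℝ) L)
  simp only [Polynomial.eval_finsetSum, bernsteinPolynomial, Polynomial.eval_mul,
    Polynomial.eval_pow, Polynomial.eval_sub, Polynomial.eval_X, Polynomial.eval_one,
    Polynomial.eval_natCast, nsmul_eq_mul] at hv
  have e : ∀ j ∈ range (L + 1), (L.choose j : ℝ) / 2 ^ (L + 1) * (2 * j - L : ℝ) ^ 2 =
      2 * ((L * (1 / 2) - j : ℝ) ^ 2 * (L.choose j * (1 / 2) ^ j * (1 - 1 / 2) ^ (L - j))) := by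
    intro j hj
    have hjL : j ≤ L := by simpa [Nat.lt_succ_iff] using hj
    have : (1 / 2 : ℝ) ^ j * (1 - 1 / 2) ^ (L - j) = 1 / 2 ^ L := by
      rw [show (1 - 1 / 2 : ℝ) = 1 / 2 by norm_num, ← pow_add, Nat.add_sub_cancel' hjL, one_div_pow]
    rw [mul_assoc (L.choose j : ℝ), this, pow_succ]
    field_simp
    ring
  rw [sum_congr rfl e, ← mul_sum, hv, two_nsmul]
  ring

/-- One-sided `ℓ¹` local limit theorem for the parity-neutral binomial distribution. -/
theorem sum_max_binDensity_sub_gauss_le {L : ℕ} (hL : 0 < L) :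
    ∑ k ∈ Icc 1 (2 * L), max (binDensity L k - gauss k L √L) 0 ≤ 4 / √L := by
  have hL0 : (0 : ℝ) < L := by exact_mod_cast hL
  have hs0 : 0 < √(L : ℝ) := Real.sqrt_pos.mpr hL0
  calc ∑ k ∈ Icc 1 (2 * L), max (binDensity L k - gauss k L √L) 0
      ≤ ∑ k ∈ Icc 1 (2 * L),
          binDensity L k * ((2 * (k / 2 : ℕ) - L : ℝ) ^ 2 / (L * √L) + 3 / √L) := by
        refine sum_le_sum fun k _ => max_le (binDensity_sub_gauss_le hL k) ?_
        have := binDensity_nonneg L k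
        positivity
    _ ≤ ∑ k ∈ range (2 * (L + 1)),
          binDensity L k * ((2 * (k / 2 : ℕ) - L : ℝ) ^ 2 / (L * √L) + 3 / √L) := by
        refine sum_le_sum_of_subset_of_nonneg (fun k hk => ?_) fun k _ _ => ?_
        · simp only [mem_Icc, mem_range] at hk ⊢; omega
        · have := binDensity_nonneg L k
          positivity
    _ = (∑ k ∈ range (2 * (L + 1)), binDensity L k * (2 * (k / 2 : ℕ) - L : ℝ) ^ 2) / (L * √L)
          + (∑ k ∈ range (2 * (L + 1)), binDensity L k) * (3 / √L) := by
        rw [sum_div, sum_mul, ← sum_add_distrib]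
        exact sum_congr rfl fun k _ => by ring
    _ = 4 / √L := by
        rw [sum_binDensity_mul_sq, sum_binDensity]
        field_simp
        norm_num

theorem summable_gauss {L : ℕ} (hL : 0 < L) :
    Summable fun k : ℕ => gauss (k + 1 : ℝ) L √L := by
  have hL0 : (0 : ℝ) < L := by exact_mod_cast hL
  unfold gauss
  refine Summable.mul_left _ ?_
  refine Summable.of_nonneg_of_le (fun k => (Real.exp_pos _).le) (fun k => ?_)
    (Real.summable_exp_neg_nat.mul_left (Real.exp (3 * L / 2)))
  rw [← Real.exp_add, Real.exp_le_exp, Real.sq_sqrt hL0.le, div_le_iff₀ (by positivity)]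
  nlinarith [sq_nonneg ((k : ℝ) + 1 - 2 * L)]

theorem norm_cesaro_le {F : ℕ → ℂ} (hF : ∀ n, ‖F n‖ ≤ 1) (N : ℕ) : ‖cesaro F N‖ ≤ 1 := by
  rw [cesaro, norm_mul, norm_div, norm_one, Complex.norm_natCast]
  have h : ‖∑ n ∈ Icc 1 N, F n‖ ≤ N := by
    simpa using norm_sum_le_of_le (Icc 1 N) (fun n _ => hF n)
  rw [one_div, inv_mul_eq_div]
  exact div_le_one_of_le₀ h (by positivity)

theorem e2bin_eq_sum (f : ℕ → ℂ) (L : ℕ) :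
    e2bin f L = ∑ k ∈ Icc 1 (2 * L), (binDensity L k : ℂ) * f k := by
  rw [e2bin, mul_sum]
  refine sum_congr rfl fun k _ => ?_
  rw [binDensity]
  push_cast
  ring

theorem sum_Icc_binDensity (L : ℕ) :
    ∑ k ∈ Icc 1 (2 * L), binDensity L k = 1 - 1 / 2 ^ L := by
  have h := sum_binDensity L
  rw [show 2 * (L + 1) = 2 * L + 1 + 1 by ring, sum_range_succ, sum_range_succ'] at h
  have e : ∑ k ∈ Icc 1 (2 * L), binDensity L k = ∑ k ∈ range (2 * L), binDensity L (k + 1) := by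
    rw [range_eq_Ico, sum_Ico_add' (fun k => binDensity L k) 0 (2 * L) 1]
    rfl
  have h0 : binDensity L 0 = 1 / 2 ^ (L + 1) := by simp [binDensity]
  have h1 : binDensity L (2 * L + 1) = 1 / 2 ^ (L + 1) := by
    simp [binDensity, show (2 * L + 1) / 2 = L by omega]
  rw [← e, h0, h1] at h
  have h2 : (1 : ℝ) / 2 ^ (L + 1) + 1 / 2 ^ (L + 1) = 1 / 2 ^ L := by
    rw [pow_succ]; field_simp; norm_num
  linarith

theorem norm_e2bin_le {f : ℕ → ℂ} (hf : ∀ n, ‖f n‖ ≤ 1) (L : ℕ) : ‖e2bin f L‖ ≤ 1 := by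
  rw [e2bin_eq_sum]
  calc ‖∑ k ∈ Icc 1 (2 * L), (binDensity L k : ℂ) * f k‖
      ≤ ∑ k ∈ Icc 1 (2 * L), binDensity L k := by
        refine norm_sum_le_of_le _ fun k _ => ?_
        rw [norm_mul, Complex.norm_real, Real.norm_of_nonneg (binDensity_nonneg L k)]
        exact mul_le_of_le_one_right (binDensity_nonneg L k) (hf k)
    _ ≤ 1 := by
        rw [sum_Icc_binDensity]
        have : (0 : ℝ) ≤ 1 / 2 ^ L := by positivity
        linarith

/-- The proportion of `n ≤ N` with `ϑ n = k`. -/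
noncomputable def freq (ϑ : ℕ → ℕ) (N k : ℕ) : ℝ :=
  (((Icc 1 N).filter (fun n => ϑ n = k)).card : ℝ) / N

theorem norm_cesaro_sub_e2bin_le (ϑ : ℕ → ℕ) {N L : ℕ} (hN : 0 < N) (hL : 0 < L)
    {f : ℕ → ℂ} (hf : ∀ n, ‖f n‖ ≤ 1) :
    ‖cesaro (fun n => f (ϑ n)) N - e2bin f L‖ ≤ 1 / 2 ^ L + 2 * (4 / √L +
      ∑' k : ℕ, |freq ϑ N (k + 1) - gauss (k + 1 : ℝ) L √L|) := by
  have hN0 : (0 : ℝ) < N := by exact_mod_cast hN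
  set M := 2 * L + 1 + (∑ n ∈ Icc 1 N, ϑ n) + 1 with hM
  have hmaps : ∀ n ∈ Icc 1 N, ϑ n ∈ range M := fun n hn => by
    have := single_le_sum (f := ϑ) (fun i _ => Nat.zero_le _) hn
    rw [mem_range]; omega
  have hsub : Icc 1 (2 * L) ⊆ range M := fun k hk => by
    rw [mem_Icc] at hk; rw [mem_range]; omega
  have hces : cesaro (fun n => f (ϑ n)) N = ∑ k ∈ range M, (freq ϑ N k : ℂ) * f k := by
    rw [cesaro, ← sum_fiberwise_of_maps_to hmaps, mul_sum]
    refine sum_congr rfl fun k _ => ?_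
    rw [sum_congr rfl (g := fun _ => f k) fun n hn => by rw [(mem_filter.mp hn).2], sum_const,
      nsmul_eq_mul, freq]
    push_cast
    ring
  have hone : ∑ k ∈ range M, freq ϑ N k = 1 := by
    unfold freq
    rw [← sum_div, div_eq_one_iff_eq hN0.ne']
    have := card_eq_sum_card_fiberwise hmaps
    rw [Nat.card_Icc] at this
    exact_mod_cast this.symm
  set q : ℕ → ℝ := fun k => if k ∈ Icc 1 (2 * L) then binDensity L k else 0 with hq
  have hqsum : ∀ u : ℕ → ℂ, ∑ k ∈ range M, (q k : ℂ) * u k =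
      ∑ k ∈ Icc 1 (2 * L), (binDensity L k : ℂ) * u k := fun u => by
    rw [← sum_subset hsub (fun k _ hk => by simp only [hq, if_neg hk]; simp)]
    exact sum_congr rfl fun k hk => by simp only [hq, if_pos hk]
  have hqone : ∑ k ∈ range M, q k = 1 - 1 / 2 ^ L := by
    rw [← sum_Icc_binDensity, ← sum_subset hsub (fun k _ hk => by simp only [hq, if_neg hk])]
    exact sum_congr rfl fun k hk => by simp only [hq, if_pos hk]
  have hfreq : ∀ k, 0 ≤ freq ϑ N k := fun k => by unfold freq; positivity
  have hpos : ∑ k ∈ range M, max (q k - freq ϑ N k) 0 ≤ 4 / √L +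
      ∑' k : ℕ, |freq ϑ N (k + 1) - gauss (k + 1 : ℝ) L √L| := by
    rw [← sum_subset hsub (fun k _ hk => by
      simp only [hq, if_neg hk]; exact max_eq_right (by linarith [hfreq k]))]
    have hsummable : Summable fun k : ℕ => |freq ϑ N (k + 1) - gauss (k + 1 : ℝ) L √L| := by
      refine Summable.abs (Summable.sub ?_ (summable_gauss hL))
      refine summable_of_ne_finset_zero (s := range M) fun k hk => ?_
      rw [freq, filter_eq_empty_iff.mpr fun n hn h => hk ?_]
      · simp
      · have := mem_range.mp (hmaps n hn)
        rw [mem_range]; omega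
    calc ∑ k ∈ Icc 1 (2 * L), max (q k - freq ϑ N k) 0
        ≤ ∑ k ∈ Icc 1 (2 * L), (max (binDensity L k - gauss k L √L) 0 +
            |freq ϑ N k - gauss k L √L|) := by
          refine sum_le_sum fun k hk => ?_
          simp only [hq, if_pos hk]
          have h1 := le_max_left (binDensity L k - gauss k L √L) 0
          have h2 := le_max_right (binDensity L k - gauss k L √L) 0
          have h3 := neg_abs_le (freq ϑ N k - gauss k L √L)
          have h4 := abs_nonneg (freq ϑ N k - gauss k L √L)
          exact max_le (by linarith) (by linarith)
      _ = ∑ k ∈ Icc 1 (2 * L), max (binDensity L k - gauss k L √L) 0 +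
            ∑ k ∈ range (2 * L), |freq ϑ N (k + 1) - gauss (k + 1 : ℝ) L √L| := by
          rw [sum_add_distrib]
          congr 1
          have := sum_Ico_add' (fun k : ℕ => |freq ϑ N k - gauss k L √L|) 0 (2 * L) 1
          push_cast at this
          rw [range_eq_Ico, this]
          rfl
      _ ≤ _ := add_le_add (sum_max_binDensity_sub_gauss_le hL)
          (hsummable.sum_le_tsum _ fun k _ => abs_nonneg _)
  rw [hces, e2bin_eq_sum, ← hqsum, ← sum_sub_distrib]
  calc ‖∑ k ∈ range M, ((freq ϑ N k : ℂ) * f k - (q k : ℂ) * f k)‖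
      ≤ ∑ k ∈ range M, (freq ϑ N k - q k + 2 * max (q k - freq ϑ N k) 0) := by
        refine norm_sum_le_of_le _ fun k _ => ?_
        rw [← sub_mul, norm_mul, ← Complex.ofReal_sub, Complex.norm_real, Real.norm_eq_abs]
        refine (mul_le_of_le_one_right (abs_nonneg _) (hf k)).trans ?_
        have h1 := le_max_left (q k - freq ϑ N k) 0
        have h2 := le_max_right (q k - freq ϑ N k) 0
        exact abs_le.mpr ⟨by linarith, by linarith⟩
    _ = 1 / 2 ^ L + 2 * ∑ k ∈ range M, max (q k - freq ϑ N k) 0 := by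
        rw [sum_add_distrib, sum_sub_distrib, hone, hqone, ← mul_sum]
        ring
    _ ≤ _ := by gcongr

theorem eventually_norm_cesaro_sub_e2bin_le {ϑ L : ℕ → ℕ} (hL : Tendsto L atTop atTop)
    (hϑ : gaussCond ϑ L) {ε : ℝ} (hε : 0 < ε) :
    ∀ᶠ N : ℕ in atTop, ∀ f : ℕ → ℂ, (∀ n, ‖f n‖ ≤ 1) →
      ‖cesaro (fun n => f (ϑ n)) N - e2bin f (L N)‖ ≤ ε := by
  have h1 : Tendsto (fun n : ℕ => (1 : ℝ) / 2 ^ n) atTop (nhds 0) := by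
    simpa using tendsto_pow_atTop_nhds_zero_of_lt_one (r := (1 / 2 : ℝ)) (by norm_num) (by norm_num)
  have h2 : Tendsto (fun n : ℕ => 4 / √(n : ℝ)) atTop (nhds 0) :=
    (Real.tendsto_sqrt_atTop.comp tendsto_natCast_atTop_atTop).const_div_atTop 4
  have h3 := (h1.comp hL).add (((h2.comp hL).add hϑ).const_mul 2)
  simp only [add_zero, mul_zero] at h3
  filter_upwards [h3.eventually_le_const hε, hL.eventually_gt_atTop 0, eventually_gt_atTop 0]
    with N hN hLN hN0 f hf
  exact (norm_cesaro_sub_e2bin_le ϑ hN0 hLN hf).trans hN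

theorem dd_succ (W : ℕ → ℝ) {n : ℕ} (hn : 1 ≤ n) : dd W (n + 1) = W (n + 1) - W n := by
  rw [dd, if_pos (by omega), Nat.add_sub_cancel]

theorem memW.eventually_dd_nonneg {W : ℕ → ℝ} (hW : memW W) : ∀ᶠ n in atTop, 0 ≤ dd W n := by
  obtain ⟨-, ⟨N₀, hmono⟩, -⟩ := hW
  filter_upwards [eventually_ge_atTop (N₀ + 2)] with n hn
  rw [dd, if_pos (by omega)]
  exact sub_nonneg.mpr (hmono _ _ (by omega) (by omega))

theorem memWstar.eventually_dd_pos {W : ℕ → ℝ} (hW : memWstar W) :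
    ∀ᶠ n in atTop, 0 < dd W n := by
  obtain ⟨hW, l, hl⟩ := hW
  suffices h : ∀ᶠ n in atTop, dd W n ≠ 0 by
    filter_upwards [h, hW.eventually_dd_nonneg] with n h1 h2 using lt_of_le_of_ne h2 h1.symm
  by_contra hzero
  have hfreq : ∃ᶠ n in atTop, dd W n = 0 := by
    simpa [Filter.Frequently] using hzero
  have hl0 : l = 0 := by
    have hmem : l ∈ closure ({0} : Set EReal) :=
      mem_closure_of_frequently_of_tendsto (hfreq.mono fun n hn => by simp [hn]) hl
    simpa using hmem
  subst hl0
  obtain ⟨n₁, hn₁⟩ := eventually_atTop.mp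
    (hl.eventually_lt_const (show (0 : EReal) < ((1 : ℝ) : EReal) by exact_mod_cast one_pos))
  obtain ⟨m, hm, hm0⟩ := (frequently_atTop.mp hfreq) (n₁ + 1)
  have hall : ∀ n, m ≤ n → dd W n = 0 := by
    intro n hn
    induction n, hn using Nat.le_induction with
    | base => exact hm0
    | succ n hn ih =>
      by_contra hne
      have h := hn₁ (n + 1) (by omega)
      rw [dd_succ (dd W) (by omega), ih, sub_zero, mul_div_assoc, div_self hne, mul_one,
        EReal.coe_lt_coe_iff] at h
      push_cast at h
      linarith [(Nat.cast_nonneg n : (0 : ℝ) ≤ n)]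
  have hconst : ∀ n, m ≤ n → W n = W m := by
    intro n hn
    induction n, hn using Nat.le_induction with
    | base => rfl
    | succ n hn ih =>
      have h := hall (n + 1) (by omega)
      rw [dd_succ W (by omega)] at h
      linarith
  obtain ⟨n, h1, h2⟩ := ((hW.2.2.eventually_gt_atTop (W m)).and (eventually_ge_atTop m)).exists
  exact h1.ne' (hconst n h2)

theorem le_of_forall_ge_succ_le {u : ℕ → ℝ} {n₀ : ℕ} (h : ∀ n, n₀ ≤ n → u n ≤ u (n + 1)) {n : ℕ}
    (hn : n₀ ≤ n) : u n₀ ≤ u n := by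
  induction n, hn using Nat.le_induction with
  | base => exact le_rfl
  | succ n hn ih => exact ih.trans (h n hn)

theorem succ_mul_dd_sub {W : ℕ → ℝ} {n : ℕ} (hn : 1 ≤ n) (h : dd W (n + 1) ≠ 0) :
    ((n + 1 : ℕ) + 1 : ℝ) * dd W (n + 1) - (n + 1) * dd W n =
      (1 + ((n + 1 : ℕ) : ℝ) * dd (dd W) (n + 1) / dd W (n + 1)) * dd W (n + 1) := by
  rw [add_mul (1 : ℝ), div_mul_cancel₀ _ h, dd_succ (dd W) hn]
  push_cast
  ring

theorem memWstar.neg_one_le {W : ℕ → ℝ} (hW : memWstar W) {l : EReal}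
    (hl : Tendsto (fun N : ℕ => (((N : ℝ) * dd (dd W) N / dd W N : ℝ) : EReal)) atTop (nhds l)) :
    ((-1 : ℝ) : EReal) ≤ l := by
  by_contra! hlt
  obtain ⟨c, hlc, hc⟩ := EReal.lt_iff_exists_real_btwn.mp hlt
  rw [EReal.coe_lt_coe_iff] at hc
  obtain ⟨n₀, hn₀⟩ := eventually_atTop.mp
    ((hl.eventually_lt_const hlc).and (hW.eventually_dd_pos.and (eventually_ge_atTop 1)))
  have hmono : ∀ n, n₀ ≤ n → (1 + c) * W n - (n + 1) * dd W n ≤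
      (1 + c) * W (n + 1) - ((n + 1 : ℕ) + 1) * dd W (n + 1) := by
    intro n hn
    obtain ⟨h1, h2, -⟩ := hn₀ (n + 1) (by omega)
    obtain ⟨-, -, h3⟩ := hn₀ n hn
    rw [EReal.coe_lt_coe_iff] at h1
    have h := succ_mul_dd_sub h3 h2.ne'
    have h4 := mul_le_mul_of_nonneg_right (add_le_add_right h1.le 1) h2.le
    rw [← h] at h4
    rw [dd_succ W h3] at h4 ⊢
    linarith
  set K := (1 + c) * W n₀ - (n₀ + 1) * dd W n₀
  obtain ⟨n, hn, hWn⟩ := ((eventually_ge_atTop n₀).and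
    ((hW.1.2.2.const_mul_atTop_of_neg (show 1 + c < 0 by linarith)).eventually_lt_atBot K)).exists
  have h5 := le_of_forall_ge_succ_le
    (u := fun n : ℕ => (1 + c) * W n - ((n : ℝ) + 1) * dd W n) hmono hn
  have h6 : 0 ≤ ((n : ℝ) + 1) * dd W n := by
    have := (hn₀ n hn).2.1
    positivity
  change (1 + c) * W n < (1 + c) * W n₀ - (n₀ + 1) * dd W n₀ at hWn
  linarith

theorem memWstar.le_neg_one {W : ℕ → ℝ} (hW : memWstar W)
    (hlog : Tendsto (fun N : ℕ => Real.log (W N) / Real.log N) atTop (nhds 0)) {l : EReal}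
    (hl : Tendsto (fun N : ℕ => (((N : ℝ) * dd (dd W) N / dd W N : ℝ) : EReal)) atTop (nhds l)) :
    l ≤ ((-1 : ℝ) : EReal) := by
  by_contra! hlt
  obtain ⟨c, hc, hlc⟩ := EReal.lt_iff_exists_real_btwn.mp hlt
  rw [EReal.coe_lt_coe_iff] at hc
  obtain ⟨δ, hδ, rfl⟩ : ∃ δ, 0 < δ ∧ c = δ - 1 := ⟨c + 1, by linarith, by ring⟩
  obtain ⟨n₀, hn₀⟩ := eventually_atTop.mp
    ((hl.eventually_const_lt hlc).and (hW.eventually_dd_pos.and (eventually_ge_atTop 1)))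
  have hmono : ∀ n, n₀ ≤ n → (n + 1) * dd W n - δ * W n ≤
      ((n + 1 : ℕ) + 1) * dd W (n + 1) - δ * W (n + 1) := by
    intro n hn
    obtain ⟨h1, h2, -⟩ := hn₀ (n + 1) (by omega)
    obtain ⟨-, -, h3⟩ := hn₀ n hn
    rw [EReal.coe_lt_coe_iff] at h1
    have h := succ_mul_dd_sub h3 h2.ne'
    have h4 := mul_le_mul_of_nonneg_right (add_le_add_right h1.le 1) h2.le
    rw [← h] at h4
    rw [dd_succ W h3] at h4 ⊢
    linarith
  set K := (n₀ + 1) * dd W n₀ - δ * W n₀ with hK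
  obtain ⟨n₁, hn₁⟩ := eventually_atTop.mp
    ((hW.1.2.2.eventually_ge_atTop (-(2 * K / δ))).and
      ((hW.1.2.2.eventually_gt_atTop 0).and (eventually_ge_atTop (n₀ + 1))))
  have hstep : ∀ n, n₁ ≤ n → Real.log (W n) - δ / 6 * Real.log n ≤
      Real.log (W (n + 1)) - δ / 6 * Real.log ((n + 1 : ℕ) : ℝ) := by
    intro n hn
    obtain ⟨-, hWn, hnn⟩ := hn₁ n hn
    obtain ⟨h1, hWn', -⟩ := hn₁ (n + 1) (by omega)
    have hn1 : (1 : ℝ) ≤ n := by exact_mod_cast (by omega : 1 ≤ n)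
    have h2 := le_of_forall_ge_succ_le
      (u := fun n : ℕ => ((n : ℝ) + 1) * dd W n - δ * W n) hmono (show n₀ ≤ n + 1 by omega)
    simp only [← hK] at h2
    have h3 : -K ≤ δ / 2 * W (n + 1) := by
      have := mul_le_mul_of_nonneg_left h1 (show 0 ≤ δ / 2 by linarith)
      have e : δ / 2 * -(2 * K / δ) = -K := by field_simp
      linarith
    rw [dd_succ W (by omega)] at h2
    push_cast at h2 ⊢
    have h4 : δ / 2 / (n + 2) ≤ 1 - (W (n + 1) / W n)⁻¹ := by
      rw [inv_div, div_le_iff₀ (by positivity), sub_mul, div_mul_eq_mul_div, one_mul,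
        le_sub_iff_add_le, ← le_sub_iff_add_le', div_le_iff₀ hWn']
      linarith
    have h5 := Real.one_sub_inv_le_log_of_pos (div_pos hWn' hWn)
    rw [Real.log_div hWn'.ne' hWn.ne'] at h5
    have h6 := Real.log_le_sub_one_of_pos (show 0 < ((n : ℝ) + 1) / n by positivity)
    rw [Real.log_div (by positivity) (by positivity)] at h6
    have h7 : δ / 6 * (((n : ℝ) + 1) / n - 1) ≤ δ / 2 / (n + 2) := by
      have e : δ / 6 * (((n : ℝ) + 1) / n - 1) = δ / 2 / (3 * n) := by
        field_simp
        norm_num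
      rw [e]
      gcongr
      linarith
    have h8 := mul_le_mul_of_nonneg_left h6 (show 0 ≤ δ / 6 by linarith)
    linarith
  set C := Real.log (W n₁) - δ / 6 * Real.log n₁ with hC
  have hlogtop : Tendsto (fun n : ℕ => Real.log n) atTop atTop :=
    Real.tendsto_log_atTop.comp tendsto_natCast_atTop_atTop
  obtain ⟨n, hn, h1, h2, h3⟩ := ((eventually_ge_atTop n₁).and
    ((hlog.eventually_lt_const (show 0 < δ / 12 by linarith)).and
      ((hlogtop.eventually_gt_atTop 0).and
        (hlogtop.eventually_gt_atTop (-(12 * C / δ)))))).exists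
  have h4 := le_of_forall_ge_succ_le
    (u := fun n : ℕ => Real.log (W n) - δ / 6 * Real.log n) hstep hn
  simp only [← hC] at h4
  rw [div_lt_iff₀ h2] at h1
  have h5 := mul_lt_mul_of_pos_left h3 (show 0 < δ / 12 by linarith)
  have e : δ / 12 * -(12 * C / δ) = -C := by field_simp
  linarith

theorem memWstar.eventually_abs_le {W : ℕ → ℝ} (hW : memWstar W)
    (hlog : Tendsto (fun N : ℕ => Real.log (W N) / Real.log N) atTop (nhds 0))
    {ε : ℝ} (hε : 0 < ε) :
    ∀ᶠ n : ℕ in atTop,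
      |dd W (n + 1) + (n + 1) * (dd W (n + 1) - dd W n)| ≤ ε * dd W (n + 1) := by
  obtain ⟨l, hl⟩ := hW.2
  have hl1 : l = ((-1 : ℝ) : EReal) := le_antisymm (hW.le_neg_one hlog hl) (hW.neg_one_le hl)
  rw [hl1, EReal.tendsto_coe] at hl
  filter_upwards [(tendsto_add_atTop_nat 1).eventually (Metric.tendsto_nhds.mp hl ε hε),
    (tendsto_add_atTop_nat 1).eventually hW.eventually_dd_pos, eventually_ge_atTop 1]
    with n h1 h2 h3
  have h := succ_mul_dd_sub h3 h2.ne'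
  have e : dd W (n + 1) + (n + 1) * (dd W (n + 1) - dd W n) =
      ((n + 1 : ℕ) + 1 : ℝ) * dd W (n + 1) - (n + 1) * dd W n := by push_cast; ring
  rw [e, h, abs_mul, abs_of_pos h2]
  refine mul_le_mul_of_nonneg_right ?_ h2.le
  rw [Real.dist_eq, sub_neg_eq_add, add_comm] at h1
  exact h1.le

/-- A uniform Stolz–Cesàro principle for a family of sequences. -/
theorem eventually_norm_le_mul_of_increment {ι E : Type*} [SeminormedAddCommGroup E] {W : ℕ → ℝ}
    (hW : Tendsto W atTop atTop) {D : ι → ℕ → E} (hD : ∀ n, ∃ K, ∀ i, ‖D i n‖ ≤ K)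
    (hstep : ∀ ε : ℝ, 0 < ε → ∀ᶠ n in atTop, ∀ i, ‖D i (n + 1) - D i n‖ ≤ ε * (W (n + 1) - W n))
    {ε : ℝ} (hε : 0 < ε) : ∀ᶠ n in atTop, ∀ i, ‖D i n‖ ≤ ε * W n := by
  obtain ⟨n₀, hn₀⟩ := eventually_atTop.mp (hstep (ε / 2) (half_pos hε))
  obtain ⟨K, hK⟩ := hD n₀
  filter_upwards [eventually_ge_atTop n₀,
    (hW.const_mul_atTop (half_pos hε)).eventually_ge_atTop (K - ε / 2 * W n₀)] with n hn hWn i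
  have h : ‖D i n‖ ≤ K + ε / 2 * (W n - W n₀) := by
    clear hWn
    induction n, hn using Nat.le_induction with
    | base => simpa using hK i
    | succ n hn ih =>
      have h1 := norm_add_le (D i n) (D i (n + 1) - D i n)
      rw [add_sub_cancel] at h1
      linarith [hn₀ n hn i]
  linarith

theorem norm_wAvg_le {W : ℕ → ℝ} {N : ℕ} (hWN : 0 < W N) {F : ℕ → ℂ} {ε : ℝ}
    (h : ‖∑ n ∈ Icc 1 N, (dd W n : ℂ) * F n‖ ≤ ε * W N) : ‖wAvg W F N‖ ≤ ε := by
  rw [wAvg, norm_mul, norm_div, norm_one, Complex.norm_real, Real.norm_of_nonneg hWN.le, one_div,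
    inv_mul_eq_div, div_le_iff₀ hWN]
  exact h

theorem wAvg_sub (W : ℕ → ℝ) (F G : ℕ → ℂ) (N : ℕ) :
    wAvg W F N - wAvg W G N = wAvg W (fun n => F n - G n) N := by
  simp only [wAvg, mul_sub, sum_sub_distrib]

/-- Weighted averages preserve uniform convergence to zero of bounded families. -/
theorem eventually_norm_wAvg_le {ι : Type*} {W : ℕ → ℝ} (hW : memW W) {F : ι → ℕ → ℂ} {B : ℝ}
    (hB : ∀ i n, ‖F i n‖ ≤ B)
    (hF : ∀ ε : ℝ, 0 < ε → ∀ᶠ n in atTop, ∀ i, ‖F i n‖ ≤ ε) {ε : ℝ} (hε : 0 < ε) :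
    ∀ᶠ N in atTop, ∀ i, ‖wAvg W (F i) N‖ ≤ ε := by
  have h := eventually_norm_le_mul_of_increment hW.2.2
    (D := fun i N => ∑ n ∈ Icc 1 N, (dd W n : ℂ) * F i n)
    (fun N => ⟨∑ n ∈ Icc 1 N, |dd W n| * B, fun i => norm_sum_le_of_le _ fun n _ => by
      rw [norm_mul, Complex.norm_real, Real.norm_eq_abs]
      exact mul_le_mul_of_nonneg_left (hB i n) (abs_nonneg _)⟩)
    (fun η hη => by
      filter_upwards [(tendsto_add_atTop_nat 1).eventually (hF η hη),
        (tendsto_add_atTop_nat 1).eventually hW.eventually_dd_nonneg, eventually_ge_atTop 1]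
        with n h1 h2 h3 i
      rw [sum_Icc_succ_top (by omega), add_sub_cancel_left, norm_mul, Complex.norm_real,
        Real.norm_of_nonneg h2, ← dd_succ W h3, mul_comm]
      exact mul_le_mul_of_nonneg_right (h1 i) h2) hε
  filter_upwards [h, hW.2.2.eventually_gt_atTop 0] with N h1 h2 i using norm_wAvg_le h2 (h1 i)

theorem memWstar.eventually_succ_mul_dd_le {W : ℕ → ℝ} (hW : memWstar W)
    (hlog : Tendsto (fun N : ℕ => Real.log (W N) / Real.log N) atTop (nhds 0))
    {ε : ℝ} (hε : 0 < ε) : ∀ᶠ n : ℕ in atTop, ((n : ℝ) + 1) * |dd W n| ≤ ε * W n := by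
  have h := eventually_norm_le_mul_of_increment hW.1.2.2
    (D := fun (_ : Unit) (n : ℕ) => ((n : ℝ) + 1) * dd W n) (fun n => ⟨_, fun _ => le_rfl⟩)
    (fun η hη => by
      filter_upwards [hW.eventually_abs_le hlog hη, eventually_ge_atTop 1] with n h1 h2 _
      rw [← dd_succ W h2, Real.norm_eq_abs]
      convert h1 using 2
      push_cast
      ring) hε
  filter_upwards [h] with n hn
  have := hn ()
  rwa [Real.norm_eq_abs, abs_mul, abs_of_nonneg (by positivity)] at this

/-- For slowly growing `W`, weighted averages of `F` agree with those of its Cesàro means. -/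
theorem memWstar.eventually_norm_wAvg_sub_cesaro_le {W : ℕ → ℝ} (hW : memWstar W)
    (hlog : Tendsto (fun N : ℕ => Real.log (W N) / Real.log N) atTop (nhds 0))
    {ε : ℝ} (hε : 0 < ε) :
    ∀ᶠ N in atTop, ∀ F : {F : ℕ → ℂ // ∀ n, ‖F n‖ ≤ 1},
      ‖wAvg W F.1 N - wAvg W (cesaro F.1) N‖ ≤ ε := by
  have hS : ∀ (F : {F : ℕ → ℂ // ∀ n, ‖F n‖ ≤ 1}) N, ‖∑ n ∈ Icc 1 N, F.1 n‖ ≤ N :=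
    fun F N => by simpa using norm_sum_le_of_le (Icc 1 N) (fun n _ => F.2 n)
  have h := eventually_norm_le_mul_of_increment hW.1.2.2
    (D := fun (F : {F : ℕ → ℂ // ∀ n, ‖F n‖ ≤ 1}) N =>
      ∑ n ∈ Icc 1 N, (dd W n : ℂ) * (F.1 n - cesaro F.1 n) - (dd W N : ℂ) * ∑ n ∈ Icc 1 N, F.1 n)
    (fun N => ⟨∑ n ∈ Icc 1 N, |dd W n| * 2 + |dd W N| * N, fun F => by
      refine (norm_sub_le _ _).trans (add_le_add (norm_sum_le_of_le _ fun n _ => ?_) ?_)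
      · rw [norm_mul, Complex.norm_real, Real.norm_eq_abs]
        refine mul_le_mul_of_nonneg_left ?_ (abs_nonneg _)
        exact (norm_sub_le _ _).trans (by linarith [F.2 n, norm_cesaro_le F.2 n])
      · rw [norm_mul, Complex.norm_real, Real.norm_eq_abs]
        exact mul_le_mul_of_nonneg_left (hS F N) (abs_nonneg _)⟩)
    (fun η hη => by
      filter_upwards [hW.eventually_abs_le hlog (half_pos hη), hW.eventually_abs_le hlog one_pos,
        (tendsto_add_atTop_nat 1).eventually hW.eventually_dd_pos, eventually_ge_atTop 1,
        tendsto_natCast_atTop_atTop.eventually_ge_atTop (4 / η)] with n h1 h2 h3 h4 h5 F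
      have hn0 : ((n : ℂ) + 1) ≠ 0 := by exact_mod_cast n.succ_ne_zero
      have hces : ∑ k ∈ Icc 1 n, F.1 k = (n + 1) * cesaro F.1 (n + 1) - F.1 (n + 1) := by
        rw [cesaro, sum_Icc_succ_top (by omega)]
        push_cast
        field_simp
        ring
      have hdiff : |dd W (n + 1) - dd W n| ≤ η / 2 * dd W (n + 1) := by
        have hn1 : (0 : ℝ) < n + 1 := by positivity
        refine le_of_mul_le_mul_left ?_ hn1
        rw [← abs_of_pos hn1, ← abs_mul, abs_of_pos hn1]
        have h6 : 2 ≤ ((n : ℝ) + 1) * (η / 2) := by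
          rw [div_le_iff₀ hη] at h5
          nlinarith
        have h7 := mul_le_mul_of_nonneg_right h6 h3.le
        rw [abs_le] at h2 ⊢
        constructor <;> linarith
      have e : (∑ k ∈ Icc 1 (n + 1), (dd W k : ℂ) * (F.1 k - cesaro F.1 k) -
            (dd W (n + 1) : ℂ) * ∑ k ∈ Icc 1 (n + 1), F.1 k) -
          (∑ k ∈ Icc 1 n, (dd W k : ℂ) * (F.1 k - cesaro F.1 k) -
            (dd W n : ℂ) * ∑ k ∈ Icc 1 n, F.1 k) =
          ((dd W (n + 1) - dd W n : ℝ) : ℂ) * F.1 (n + 1) -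
          ((dd W (n + 1) + (n + 1) * (dd W (n + 1) - dd W n) : ℝ) : ℂ) * cesaro F.1 (n + 1) := by
        rw [sum_Icc_succ_top (by omega), sum_Icc_succ_top (by omega), hces]
        push_cast
        ring
      rw [e, ← dd_succ W h4]
      refine (norm_sub_le _ _).trans ?_
      rw [norm_mul, norm_mul, Complex.norm_real, Complex.norm_real, Real.norm_eq_abs,
        Real.norm_eq_abs]
      have h8 := mul_le_of_le_one_right (abs_nonneg (dd W (n + 1) - dd W n)) (F.2 (n + 1))
      have h9 := mul_le_of_le_one_right
        (abs_nonneg (dd W (n + 1) + (n + 1) * (dd W (n + 1) - dd W n)))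
        (norm_cesaro_le F.2 (n + 1))
      linarith) (half_pos hε)
  filter_upwards [h, hW.1.2.2.eventually_gt_atTop 0,
    hW.eventually_succ_mul_dd_le hlog (half_pos hε)] with N h1 h2 h3 F
  rw [wAvg_sub]
  refine norm_wAvg_le h2 ?_
  have h4 : ‖(dd W N : ℂ) * ∑ n ∈ Icc 1 N, F.1 n‖ ≤ ε / 2 * W N := by
    rw [norm_mul, Complex.norm_real, Real.norm_eq_abs]
    refine le_trans ?_ h3
    rw [mul_comm]
    exact mul_le_mul_of_nonneg_right ((hS F N).trans (by linarith)) (abs_nonneg _)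
  have h5 := norm_add_le _ _ |>.trans (add_le_add (h1 F) h4)
  rw [sub_add_cancel] at h5
  linarith

/-- part 2 of the main theorem.
If `W ∈ 𝒲*` with `log W(N)/log N → 0`, `L ∈ ℒ`, and `ϑ` satisfies the Gaussian condition
w.r.t. `L`, then uniformly over all `f` with `‖f‖_∞ ≤ 1`,
`E^W_{n≤N} f(ϑ(n)) = E^W_{n≤N} (E^{2bin}_{k≤L(n)} f(k)) + o(1)`. -/
theorem stmt1 (W : ℕ → ℝ) (hW : memWstar W)
    (hlog : Tendsto (fun N : ℕ => Real.log (W N) / Real.log N) atTop (nhds 0))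
    (L : ℕ → ℕ) (ϑ : ℕ → ℕ) (hL : memL L) (hϑ : gaussCond ϑ L) :
    ∀ ε : ℝ, 0 < ε → ∀ᶠ N : ℕ in atTop, ∀ f : ℕ → ℂ, (∀ n, ‖f n‖ ≤ 1) →
      ‖wAvg W (fun n => f (ϑ n)) N - wAvg W (fun n => e2bin f (L n)) N‖ < ε := by
  intro ε hε
  have hL' : Tendsto L atTop atTop := tendsto_natCast_atTop_iff.mp hL.1.2.2
  have hF : ∀ η : ℝ, 0 < η → ∀ᶠ n in atTop, ∀ f : {f : ℕ → ℂ // ∀ n, ‖f n‖ ≤ 1},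
      ‖cesaro (fun n => f.1 (ϑ n)) n - e2bin f.1 (L n)‖ ≤ η := fun η hη => by
    filter_upwards [eventually_norm_cesaro_sub_e2bin_le hL' hϑ hη] with n hn f using hn f.1 f.2
  have hB : ∀ (f : {f : ℕ → ℂ // ∀ n, ‖f n‖ ≤ 1}) (n : ℕ),
      ‖cesaro (fun n => f.1 (ϑ n)) n - e2bin f.1 (L n)‖ ≤ 2 := fun f n =>
    (norm_sub_le _ _).trans (by
      linarith [norm_cesaro_le (fun n => f.2 (ϑ n)) n, norm_e2bin_le f.2 (L n)])
  filter_upwards [hW.eventually_norm_wAvg_sub_cesaro_le hlog (show 0 < ε / 3 by linarith),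
    eventually_norm_wAvg_le hW.1 hB hF (show 0 < ε / 3 by linarith)] with N h1 h2 f hf
  have h3 := h1 ⟨fun n => f (ϑ n), fun n => hf (ϑ n)⟩
  have h4 := h2 ⟨f, hf⟩
  rw [← wAvg_sub] at h4
  refine (norm_sub_le_norm_sub_add_norm_sub _ (wAvg W (cesaro fun n => f (ϑ n)) N) _).trans_lt ?_
  exact (add_le_add h3 h4).trans_lt (by linarith)
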